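/- arXiv:2406.09917 — 11 statements merged into one kernel-verified Lean document; each statement's English description precedes it below -/
import Mathlib

section
/- Let f_{s1}, f_{s2}, g_{s1}, g_{s2}, h_s (s=1,2) and κ1, κ2 be as in the context, with (κ1,κ2) ≠ (0,0). For s = 1,2 let φ_{s,1}, …, φ_{s,n_s} : ℝ → ℝ be twice continuously differentiable functions and let W_s be their real linear span. Let ℓ : ℝ² → ℝ be ℓ(x1,x2) = κ1·x1 + κ2·x2. Then the following are equivalent: (i) for all v1 ∈ W_1 and v2 ∈ W_2 one has F_s(v1,v2) ∈ W_s for s = 1,2; (ii) for all v1 ∈ W_1 and v2 ∈ W_2 there exist w_1 ∈ W_1 and w_2 ∈ W_2 such that H_s(v1∘ℓ, v2∘ℓ)(x1,x2) = w_s(ℓ(x1,x2)) for all (x1,x2) ∈ ℝ² and s = 1,2. -/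
/-- First-variable partial derivative of a function of two real variables. -/
noncomputable def pd1 (u : ℝ × ℝ → ℝ) (p : ℝ × ℝ) : ℝ :=
  deriv (fun x => u (x, p.2)) p.1

/-- Second-variable partial derivative of a function of two real variables. -/
noncomputable def pd2 (u : ℝ × ℝ → ℝ) (p : ℝ × ℝ) : ℝ :=
  deriv (fun y => u (p.1, y)) p.2

/-- The (2+1)-dimensional reaction–diffusion operator
`H(u1,u2) = ∂/∂x1(f1(u1,u2)·∂u1/∂x1 + f2(u1,u2)·∂u2/∂x1)
          + ∂/∂x2(g1(u1,u2)·∂u1/∂x2 + g2(u1,u2)·∂u2/∂x2) + h(u1,u2)`. -/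
noncomputable def Hop (f1 f2 g1 g2 h : ℝ × ℝ → ℝ) (u1 u2 : ℝ × ℝ → ℝ) (p : ℝ × ℝ) : ℝ :=
  deriv (fun x => f1 (u1 (x, p.2), u2 (x, p.2)) * pd1 u1 (x, p.2)
        + f2 (u1 (x, p.2), u2 (x, p.2)) * pd1 u2 (x, p.2)) p.1
  + deriv (fun y => g1 (u1 (p.1, y), u2 (p.1, y)) * pd2 u1 (p.1, y)
        + g2 (u1 (p.1, y), u2 (p.1, y)) * pd2 u2 (p.1, y)) p.2
  + h (u1 p, u2 p)

/-- The reduced (1+1)-dimensional operator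
`F(v1,v2)(z) = d/dz[(κ1²f1+κ2²g1)(v1,v2)·v1' + (κ1²f2+κ2²g2)(v1,v2)·v2'] + h(v1,v2)`. -/
noncomputable def Fop (κ1 κ2 : ℝ) (f1 f2 g1 g2 h : ℝ × ℝ → ℝ) (v1 v2 : ℝ → ℝ) (z : ℝ) : ℝ :=
  deriv (fun w => (κ1 ^ 2 * f1 (v1 w, v2 w) + κ2 ^ 2 * g1 (v1 w, v2 w)) * deriv v1 w
        + (κ1 ^ 2 * f2 (v1 w, v2 w) + κ2 ^ 2 * g2 (v1 w, v2 w)) * deriv v2 w) z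
  + h (v1 z, v2 z)

theorem differentiable_flux {a b : ℝ × ℝ → ℝ} {v1 v2 : ℝ → ℝ}
    (ha : ContDiff ℝ 1 a) (hb : ContDiff ℝ 1 b) (hv1 : ContDiff ℝ 2 v1) (hv2 : ContDiff ℝ 2 v2) :
    Differentiable ℝ (fun z => a (v1 z, v2 z) * deriv v1 z + b (v1 z, v2 z) * deriv v2 z) := by
  have da := ha.differentiable one_ne_zero
  have db := hb.differentiable one_ne_zero
  have d1 := hv1.differentiable two_ne_zero
  have d2 := hv2.differentiable two_ne_zero
  have dd1 := hv1.differentiable_deriv_two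
  have dd2 := hv2.differentiable_deriv_two
  fun_prop

theorem deriv_comp_linear_fst {v : ℝ → ℝ} (hv : Differentiable ℝ v) (κ1 κ2 x y : ℝ) :
    deriv (fun x => v (κ1 * x + κ2 * y)) x = κ1 * deriv v (κ1 * x + κ2 * y) := by
  have hl : HasDerivAt (fun x => κ1 * x + κ2 * y) κ1 x := by
    simpa using ((hasDerivAt_id x).const_mul κ1).add_const (κ2 * y)
  exact ((hv _).hasDerivAt.comp x hl).deriv.trans (mul_comm _ _)

theorem deriv_comp_linear_snd {v : ℝ → ℝ} (hv : Differentiable ℝ v) (κ1 κ2 x y : ℝ) :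
    deriv (fun y => v (κ1 * x + κ2 * y)) y = κ2 * deriv v (κ1 * x + κ2 * y) := by
  simpa only [add_comm] using deriv_comp_linear_fst hv κ2 κ1 y x

theorem Hop_comp_linear (κ1 κ2 : ℝ) {f1 f2 g1 g2 : ℝ × ℝ → ℝ} (h : ℝ × ℝ → ℝ) {v1 v2 : ℝ → ℝ}
    (hf1 : ContDiff ℝ 1 f1) (hf2 : ContDiff ℝ 1 f2) (hg1 : ContDiff ℝ 1 g1)
    (hg2 : ContDiff ℝ 1 g2) (hv1 : ContDiff ℝ 2 v1) (hv2 : ContDiff ℝ 2 v2) (x1 x2 : ℝ) :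
    Hop f1 f2 g1 g2 h (fun p => v1 (κ1 * p.1 + κ2 * p.2)) (fun p => v2 (κ1 * p.1 + κ2 * p.2))
        (x1, x2)
      = Fop κ1 κ2 f1 f2 g1 g2 h v1 v2 (κ1 * x1 + κ2 * x2) := by
  have d1 := hv1.differentiable two_ne_zero
  have d2 := hv2.differentiable two_ne_zero
  have hP := differentiable_flux hf1 hf2 hv1 hv2
  have hQ := differentiable_flux hg1 hg2 hv1 hv2
  set P := fun z => f1 (v1 z, v2 z) * deriv v1 z + f2 (v1 z, v2 z) * deriv v2 z with hPdef
  set Q := fun z => g1 (v1 z, v2 z) * deriv v1 z + g2 (v1 z, v2 z) * deriv v2 z with hQdef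
  have hF : (fun w => (κ1 ^ 2 * f1 (v1 w, v2 w) + κ2 ^ 2 * g1 (v1 w, v2 w)) * deriv v1 w
      + (κ1 ^ 2 * f2 (v1 w, v2 w) + κ2 ^ 2 * g2 (v1 w, v2 w)) * deriv v2 w)
      = fun w => κ1 ^ 2 * P w + κ2 ^ 2 * Q w := by
    funext w
    simp only [hPdef, hQdef]
    ring
  have hFd : deriv (fun w => κ1 ^ 2 * P w + κ2 ^ 2 * Q w) (κ1 * x1 + κ2 * x2)
      = κ1 ^ 2 * deriv P (κ1 * x1 + κ2 * x2) + κ2 ^ 2 * deriv Q (κ1 * x1 + κ2 * x2) :=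
    (((hP _).hasDerivAt.const_mul _).add ((hQ _).hasDerivAt.const_mul _)).deriv
  have h1 : (fun x => f1 (v1 (κ1 * x + κ2 * x2), v2 (κ1 * x + κ2 * x2))
        * (κ1 * deriv v1 (κ1 * x + κ2 * x2))
      + f2 (v1 (κ1 * x + κ2 * x2), v2 (κ1 * x + κ2 * x2)) * (κ1 * deriv v2 (κ1 * x + κ2 * x2)))
      = fun x => κ1 * P (κ1 * x + κ2 * x2) := by
    funext x
    simp only [hPdef]
    ring
  have h2 : (fun y => g1 (v1 (κ1 * x1 + κ2 * y), v2 (κ1 * x1 + κ2 * y))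
        * (κ2 * deriv v1 (κ1 * x1 + κ2 * y))
      + g2 (v1 (κ1 * x1 + κ2 * y), v2 (κ1 * x1 + κ2 * y)) * (κ2 * deriv v2 (κ1 * x1 + κ2 * y)))
      = fun y => κ2 * Q (κ1 * x1 + κ2 * y) := by
    funext y
    simp only [hQdef]
    ring
  simp only [Hop, Fop, pd1, pd2, deriv_comp_linear_fst d1, deriv_comp_linear_fst d2,
    deriv_comp_linear_snd d1, deriv_comp_linear_snd d2]
  rw [hF, hFd, h1, h2, deriv_const_mul_field, deriv_const_mul_field,
    deriv_comp_linear_fst hP, deriv_comp_linear_snd hQ]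
  ring

theorem contDiff_of_mem_span {ι : Type*} {φ : ι → ℝ → ℝ} {k : WithTop ℕ∞}
    (hφ : ∀ i, ContDiff ℝ k (φ i)) {v : ℝ → ℝ} (hv : v ∈ Submodule.span ℝ (Set.range φ)) :
    ContDiff ℝ k v := by
  induction hv using Submodule.span_induction with
  | mem x hx =>
    obtain ⟨i, rfl⟩ := hx
    exact hφ i
  | zero => exact contDiff_const
  | add x y _ _ hx hy => exact hx.add hy
  | smul c x _ hx => exact contDiff_const.mul hx

theorem exists_linear_eq {κ1 κ2 : ℝ} (hκ : (κ1, κ2) ≠ (0, 0)) (z : ℝ) :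
    ∃ x1 x2 : ℝ, κ1 * x1 + κ2 * x2 = z := by
  by_cases h1 : κ1 = 0
  · have h2 : κ2 ≠ 0 := fun h2 => hκ (by rw [h1, h2])
    exact ⟨0, z / κ2, by field_simp; ring⟩
  · exact ⟨z / κ1, 0, by field_simp; ring⟩

/-- invariance of the linear product space `W1 × W2` under the reduced
operators `F_s` is equivalent to invariance under the original operators `H_s`
composed with the variable transformation `ℓ(x1,x2) = κ1·x1 + κ2·x2`. -/
theorem stmt1 (κ1 κ2 : ℝ) (hκ : (κ1, κ2) ≠ (0, 0))
    (f g : Fin 2 → Fin 2 → ℝ × ℝ → ℝ) (h : Fin 2 → ℝ × ℝ → ℝ)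
    (hf : ∀ s i, ContDiff ℝ 1 (f s i)) (hg : ∀ s i, ContDiff ℝ 1 (g s i))
    (hh : ∀ s, Continuous (h s))
    (n : Fin 2 → ℕ) (φ : (s : Fin 2) → Fin (n s) → ℝ → ℝ)
    (hφ : ∀ s i, ContDiff ℝ 2 (φ s i))
    (W : Fin 2 → Submodule ℝ (ℝ → ℝ))
    (hW : ∀ s, W s = Submodule.span ℝ (Set.range (φ s))) :
    (∀ v1 ∈ W 0, ∀ v2 ∈ W 1, ∀ s : Fin 2,
        Fop κ1 κ2 (f s 0) (f s 1) (g s 0) (g s 1) (h s) v1 v2 ∈ W s)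
    ↔
    (∀ v1 ∈ W 0, ∀ v2 ∈ W 1, ∃ w : Fin 2 → ℝ → ℝ, (∀ s, w s ∈ W s) ∧
        ∀ s : Fin 2, ∀ x1 x2 : ℝ,
          Hop (f s 0) (f s 1) (g s 0) (g s 1) (h s)
            (fun p => v1 (κ1 * p.1 + κ2 * p.2)) (fun p => v2 (κ1 * p.1 + κ2 * p.2)) (x1, x2)
          = w s (κ1 * x1 + κ2 * x2)) := by
  have key : ∀ v1 ∈ W 0, ∀ v2 ∈ W 1, ∀ (s : Fin 2) (x1 x2 : ℝ),
      Hop (f s 0) (f s 1) (g s 0) (g s 1) (h s)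
          (fun p => v1 (κ1 * p.1 + κ2 * p.2)) (fun p => v2 (κ1 * p.1 + κ2 * p.2)) (x1, x2)
        = Fop κ1 κ2 (f s 0) (f s 1) (g s 0) (g s 1) (h s) v1 v2 (κ1 * x1 + κ2 * x2) := by
    intro v1 hv1 v2 hv2 s
    rw [hW] at hv1 hv2
    exact Hop_comp_linear κ1 κ2 (h s) (hf s 0) (hf s 1) (hg s 0) (hg s 1)
      (contDiff_of_mem_span (hφ 0) hv1) (contDiff_of_mem_span (hφ 1) hv2)
  constructor
  · intro H v1 hv1 v2 hv2
    exact ⟨_, H v1 hv1 v2 hv2, key v1 hv1 v2 hv2⟩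
  · intro H v1 hv1 v2 hv2 s
    obtain ⟨w, hw, hHw⟩ := H v1 hv1 v2 hv2
    convert hw s using 1
    funext z
    obtain ⟨x1, x2, rfl⟩ := exists_linear_eq hκ z
    rw [← key v1 hv1 v2 hv2, hHw]
end

section
/- Fix real parameters κ1, γ_{s0}, γ_{s1}, γ_{s2}, γ_{s3}, γ_{s4}, γ_{s5}, η_{s0}, …, η_{s8}, μ_{s0}, μ_{s1}, μ_{s2} for s = 1,2, and define, for real numbers w1, w2: Φ_s(w1,w2) = κ1²·[ γ_{s0} + γ_{s1}·w1 + (γ_{s2} + γ_{s3}·w1)·w2 + (1/2)·(γ_{s4}·w2² + γ_{s5}·w1²) − (1/2)·((η_{s8}/3)·w1² + η_{s7}·w1·w2 + η_{s6}·w2²)·w2 ], Ψ_s(w1,w2) = κ1²·[ η_{s0} + η_{s1}·w1 + (η_{s2} + η_{s3}·w1)·w2 + (1/2)·(η_{s4}·w2² + η_{s5}·w1²) + (1/2)·((η_{s8}/3)·w1² + η_{s7}·w1·w2 + η_{s6}·w2²)·w1 ], and h_s(w1,w2) = μ_{s0} + μ_{s1}·w1 + μ_{s2}·w2. For twice continuously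 differentiable v1, v2 : ℝ → ℝ define A_s(v1,v2)(z) = d/dz[ Φ_s(v1(z),v2(z))·v1'(z) + Ψ_s(v1(z),v2(z))·v2'(z) ] + h_s(v1(z),v2(z)). Then for every pair of affine functions v1(z) = p1 + p2·z and v2(z) = q1 + q2·z (p1,p2,q1,q2 ∈ ℝ), the functions A_1(v1,v2) and A_2(v1,v2) both lie in the real linear span of the functions z ↦ 1 and z ↦ z. -/
/-- The reduced two-component operator
`A(v1,v2)(z) = d/dz[Φ(v1(z),v2(z))·v1'(z) + Ψ(v1(z),v2(z))·v2'(z)] + h(v1(z),v2(z))`. -/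
noncomputable def Aop (Φ Ψ h : ℝ → ℝ → ℝ) (v1 v2 : ℝ → ℝ) (z : ℝ) : ℝ :=
  deriv (fun w => Φ (v1 w) (v2 w) * deriv v1 w + Ψ (v1 w) (v2 w) * deriv v2 w) z
  + h (v1 z) (v2 z)

/-- If the flux is a quadratic polynomial and the reaction term is affine in the independent
variable, then `Aop Φ Ψ h v1 v2` lies in the span of `1` and `z`. -/
theorem Aop_mem_span_of_quadratic_flux {Φ Ψ h : ℝ → ℝ → ℝ} {v1 v2 : ℝ → ℝ} (a b c d e : ℝ)
    (hflux : ∀ w, Φ (v1 w) (v2 w) * deriv v1 w + Ψ (v1 w) (v2 w) * deriv v2 w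
      = a + b * w + c * w ^ 2)
    (hreact : ∀ z, h (v1 z) (v2 z) = d + e * z) :
    Aop Φ Ψ h v1 v2 ∈ Submodule.span ℝ ({fun _ => (1 : ℝ), fun z => z} : Set (ℝ → ℝ)) := by
  rw [Submodule.mem_span_pair]
  refine ⟨b + d, 2 * c + e, ?_⟩
  funext z
  have hderiv : HasDerivAt (fun w : ℝ => a + b * w + c * w ^ 2) (b + 2 * c * z) z := by
    refine ((((hasDerivAt_id' z).const_mul b).const_add a).add
      ((hasDerivAt_pow 2 z).const_mul c)).congr_deriv ?_
    norm_num
    ring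
  simp only [Aop, hflux, hreact, hderiv.deriv, Pi.add_apply, Pi.smul_apply, smul_eq_mul]
  ring

theorem deriv_const_add_mul (p q z : ℝ) : deriv (fun x : ℝ => p + q * x) z = q := by
  simp

/-- Table 1, case 1: for the displayed coefficient functions, the operators
`A_1, A_2` map pairs of affine functions into the span of `{1, z}`. -/
theorem stmt6 (κ1 : ℝ) (γ : Fin 2 → Fin 6 → ℝ) (η : Fin 2 → Fin 9 → ℝ)
    (μ : Fin 2 → Fin 3 → ℝ) :
    ∀ p1 p2 q1 q2 : ℝ, ∀ s : Fin 2,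
      Aop
        (fun w1 w2 => κ1 ^ 2 * (γ s 0 + γ s 1 * w1 + (γ s 2 + γ s 3 * w1) * w2
          + (1 / 2) * (γ s 4 * w2 ^ 2 + γ s 5 * w1 ^ 2)
          - (1 / 2) * ((η s 8 / 3) * w1 ^ 2 + η s 7 * w1 * w2 + η s 6 * w2 ^ 2) * w2))
        (fun w1 w2 => κ1 ^ 2 * (η s 0 + η s 1 * w1 + (η s 2 + η s 3 * w1) * w2
          + (1 / 2) * (η s 4 * w2 ^ 2 + η s 5 * w1 ^ 2)
          + (1 / 2) * ((η s 8 / 3) * w1 ^ 2 + η s 7 * w1 * w2 + η s 6 * w2 ^ 2) * w1))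
        (fun w1 w2 => μ s 0 + μ s 1 * w1 + μ s 2 * w2)
        (fun z => p1 + p2 * z) (fun z => q1 + q2 * z)
      ∈ Submodule.span ℝ ({fun _ => (1 : ℝ), fun z => z} : Set (ℝ → ℝ)) := by
  intro p1 p2 q1 q2 s
  refine Aop_mem_span_of_quadratic_flux
    (κ1 ^ 2 * (p2 * (γ s 0 + γ s 1 * p1 + γ s 2 * q1 + γ s 3 * (p1 * q1)
        + (1 / 2) * (γ s 4 * (q1 ^ 2) + γ s 5 * (p1 ^ 2)))
      + q2 * (η s 0 + η s 1 * p1 + η s 2 * q1 + η s 3 * (p1 * q1)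
        + (1 / 2) * (η s 4 * (q1 ^ 2) + η s 5 * (p1 ^ 2)))
      + (1 / 2) * (p1 * q2 - q1 * p2) * (η s 8 / 3 * (p1 ^ 2) + η s 7 * (p1 * q1)
        + η s 6 * (q1 ^ 2))))
    (κ1 ^ 2 * (p2 * (γ s 1 * p2 + γ s 2 * q2 + γ s 3 * (p1 * q2 + p2 * q1)
        + (1 / 2) * (γ s 4 * (2 * q1 * q2) + γ s 5 * (2 * p1 * p2)))
      + q2 * (η s 1 * p2 + η s 2 * q2 + η s 3 * (p1 * q2 + p2 * q1)
        + (1 / 2) * (η s 4 * (2 * q1 * q2) + η s 5 * (2 * p1 * p2)))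
      + (1 / 2) * (p1 * q2 - q1 * p2) * (η s 8 / 3 * (2 * p1 * p2) + η s 7 * (p1 * q2 + p2 * q1)
        + η s 6 * (2 * q1 * q2))))
    (κ1 ^ 2 * (p2 * (γ s 3 * (p2 * q2)
        + (1 / 2) * (γ s 4 * (q2 ^ 2) + γ s 5 * (p2 ^ 2)))
      + q2 * (η s 3 * (p2 * q2)
        + (1 / 2) * (η s 4 * (q2 ^ 2) + η s 5 * (p2 ^ 2)))
      + (1 / 2) * (p1 * q2 - q1 * p2) * (η s 8 / 3 * (p2 ^ 2) + η s 7 * (p2 * q2)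
        + η s 6 * (q2 ^ 2))))
    (μ s 0 + μ s 1 * p1 + μ s 2 * q1) (μ s 1 * p2 + μ s 2 * q2) (fun w => ?_) (fun z => ?_)
  · simp only [deriv_const_add_mul]
    ring
  · ring
end

section
/- Fix real parameters κ1, γ10, γ11, γ12, γ20, γ21, η20, μ10, μ11, μ21, μ22, μ23 and λ > 0, and let σ = √λ or σ = −√λ. For twice continuously differentiable v1, v2 : ℝ → ℝ define A_1(v1,v2)(z) = d/dz[ κ1²·(γ10 + γ11·v1(z) + (γ12/2)·v1(z)²)·v1'(z) ] + μ10 + μ11·v1(z) and A_2(v1,v2)(z) = d/dz[ ( (2μ23/λ)·v1(z)·v2(z) + κ1²·(γ20 + γ21·v2(z)) )·v1'(z) + ( κ1²·η20 − (1/λ)·((μ23/2)·v1(z)² + μ22·v1(z)) )·v2'(z) ] + ( μ21 + μ22·v1(z) + (μ23/2)·v1(z)² )·v2(z). Then for every affine function v1(z) = p1 + p2·z and every v2 in the real linear span of z ↦ e^{σz} and z ↦ z·e^{σz}, the function A_1(v1,v2) lies in the real linear span of z ↦ 1 and z ↦ z, and A_2(v1,v2) lies in the real linear span of z ↦ e^{σz}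 and z ↦ z·e^{σz}. -/
theorem hasDerivAt_add_mul_exp (a b s z : ℝ) :
    HasDerivAt (fun w : ℝ => a * Real.exp (s * w) + b * (w * Real.exp (s * w)))
      ((s * a + b) * Real.exp (s * z) + s * b * (z * Real.exp (s * z))) z := by
  have hE : HasDerivAt (fun w : ℝ => Real.exp (s * w)) (Real.exp (s * z) * (s * 1)) z :=
    ((hasDerivAt_id' z).const_mul s).exp
  exact ((hE.const_mul a).add (((hasDerivAt_id' z).mul hE).const_mul b)).congr_deriv (by ring)

theorem hasDerivAt_const_add_const_mul (a b z : ℝ) :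
    HasDerivAt (fun w : ℝ => a + b * w) b z := by
  simpa using ((hasDerivAt_id' z).const_mul b).const_add a

/-- Table 1, case 4: for the displayed coefficient functions, `A_1` maps
`span{1,z} × span{e^{σz}, z·e^{σz}}` into `span{1,z}` and `A_2` maps it into
`span{e^{σz}, z·e^{σz}}`, where `σ = ±√λ`, `λ > 0`. -/
theorem stmt7 (κ1 γ10 γ11 γ12 γ20 γ21 η20 μ10 μ11 μ21 μ22 μ23 lam σ : ℝ)
    (hlam : 0 < lam) (hσ : σ = Real.sqrt lam ∨ σ = -Real.sqrt lam) :
    ∀ p1 p2 : ℝ,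
    ∀ v2 ∈ Submodule.span ℝ
        ({fun z => Real.exp (σ * z), fun z => z * Real.exp (σ * z)} : Set (ℝ → ℝ)),
      (Aop (fun w1 _ => κ1 ^ 2 * (γ10 + γ11 * w1 + (γ12 / 2) * w1 ^ 2))
          (fun _ _ => 0)
          (fun w1 _ => μ10 + μ11 * w1)
          (fun z => p1 + p2 * z) v2
        ∈ Submodule.span ℝ ({fun _ => (1 : ℝ), fun z => z} : Set (ℝ → ℝ)))
      ∧
      (Aop (fun w1 w2 => (2 * μ23 / lam) * w1 * w2 + κ1 ^ 2 * (γ20 + γ21 * w2))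
          (fun w1 _ => κ1 ^ 2 * η20 - (1 / lam) * ((μ23 / 2) * w1 ^ 2 + μ22 * w1))
          (fun w1 w2 => (μ21 + μ22 * w1 + (μ23 / 2) * w1 ^ 2) * w2)
          (fun z => p1 + p2 * z) v2
        ∈ Submodule.span ℝ
            ({fun z => Real.exp (σ * z), fun z => z * Real.exp (σ * z)} : Set (ℝ → ℝ))) := by
  intro p1 p2 v2 hv2
  have hsq : lam = σ ^ 2 := by
    rcases hσ with h | h <;> simp [h, Real.sq_sqrt hlam.le]
  have hσ0 : σ ≠ 0 := by
    rintro rfl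
    simp [hsq] at hlam
  clear hσ hlam
  subst hsq
  obtain ⟨a, b, rfl⟩ := Submodule.mem_span_pair.1 hv2
  have hV := hasDerivAt_const_add_const_mul p1 p2
  have hdV : deriv (fun z : ℝ => p1 + p2 * z) = fun _ => p2 := funext fun z => (hV z).deriv
  constructor
  · refine Submodule.mem_span_pair.2
      ⟨κ1 ^ 2 * p2 ^ 2 * (γ11 + γ12 * p1) + μ10 + μ11 * p1,
        κ1 ^ 2 * p2 ^ 2 * γ12 * p2 + μ11 * p2, ?_⟩
    funext z
    have h := (((((hV z).const_mul γ11).const_add γ10).add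
      (((hV z).pow 2).const_mul (γ12 / 2))).const_mul (κ1 ^ 2)).mul_const p2
    simp only [Aop, hdV, zero_mul, add_zero]
    erw [h.deriv]
    simp only [Pi.add_apply, Pi.smul_apply, smul_eq_mul]
    push_cast
    ring
  · have hf : (a • (fun z => Real.exp (σ * z)) + b • fun z => z * Real.exp (σ * z)) =
        fun z : ℝ => a * Real.exp (σ * z) + b * (z * Real.exp (σ * z)) := rfl
    rw [hf]
    have hW := hasDerivAt_add_mul_exp a b σ
    have hdW := funext fun z => (hW z).deriv
    have hW' := hasDerivAt_add_mul_exp (σ * a + b) (σ * b) σ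
    refine Submodule.mem_span_pair.2
      ⟨(2 * μ23 / σ ^ 2) * p2 * (p2 * a + p1 * (σ * a + b)) + κ1 ^ 2 * γ21 * p2 * (σ * a + b)
          + κ1 ^ 2 * η20 * (σ ^ 2 * a + 2 * σ * b)
          - (1 / σ ^ 2) * (μ23 * p1 + μ22) * p2 * (σ * a + b)
          - (2 * σ * b / σ ^ 2) * (μ23 / 2 * p1 ^ 2 + μ22 * p1) + μ21 * a,
        (2 * μ23 / σ ^ 2) * p2 * (p2 * b + p1 * σ * b + p2 * (σ * a + b))
          + κ1 ^ 2 * γ21 * p2 * σ * b + κ1 ^ 2 * η20 * σ ^ 2 * b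
          - (1 / σ ^ 2) * p2 * ((μ23 * p1 + μ22) * σ * b + μ23 * p2 * (σ * a + b))
          - (2 * σ * b / σ ^ 2) * (μ23 * p1 * p2 + μ22 * p2) + μ21 * b, ?_⟩
    funext z
    have hΦ := ((((hV z).const_mul (2 * μ23 / σ ^ 2)).mul (hW z)).add
      ((((hW z).const_mul γ21).const_add γ20).const_mul (κ1 ^ 2))).mul_const p2
    have hΨ := ((((((hV z).pow 2).const_mul (μ23 / 2)).add
      ((hV z).const_mul μ22)).const_mul (1 / σ ^ 2)).const_sub (κ1 ^ 2 * η20)).mul (hW' z)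
    simp only [Aop, hdV, hdW]
    erw [(hΦ.add hΨ).deriv]
    simp only [Pi.add_apply, Pi.smul_apply, Pi.pow_apply, smul_eq_mul]
    push_cast
    field_simp
    ring
end

section
/- Fix real parameters κ1, γ10, γ11, γ12, γ20, γ21, η20, μ10, μ11, μ20, and r1, r2 ∈ ℝ. For twice continuously differentiable v1, v2 : ℝ → ℝ define A_1(v1,v2)(z) = d/dz[ κ1²·(γ10 + γ11·v1(z) + (γ12/2)·v1(z)²)·v1'(z) ] + μ10 + μ11·v1(z) and A_2(v1,v2)(z) = d/dz[ κ1²·(γ20 + γ21·v2(z))·v1'(z) + κ1²·η20·v2'(z) ] + μ20·v2(z). Then for every affine function v1(z) = p1 + p2·z and every v2 in the real linear span of z ↦ e^{r1·z} and z ↦ e^{r2·z}, the function A_1(v1,v2) lies in the real linear span of z ↦ 1 and z ↦ z, and A_2(v1,v2) lies in the real linear span of z ↦ e^{r1·z} and z ↦ e^{r2·z}. -/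
theorem hasDerivAt_affine (a b z : ℝ) : HasDerivAt (fun w => a + b * w) b z := by
  simpa using ((hasDerivAt_id z).const_mul b).const_add a

theorem hasDerivAt_exp_combination (a b r s z : ℝ) :
    HasDerivAt (fun w => a * Real.exp (r * w) + b * Real.exp (s * w))
      (a * r * Real.exp (r * z) + b * s * Real.exp (s * z)) z := by
  have h (t : ℝ) : HasDerivAt (fun w => Real.exp (t * w)) (Real.exp (t * z) * t) z := by
    simpa using ((hasDerivAt_id z).const_mul t).exp
  exact (((h r).const_mul a).add ((h s).const_mul b)).congr_deriv (by ring)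

/-- Table 1, case 5: for the displayed coefficient functions, `A_1` maps
`span{1,z} × span{e^{r1·z}, e^{r2·z}}` into `span{1,z}` and `A_2` maps it into
`span{e^{r1·z}, e^{r2·z}}`. -/
theorem stmt8 (κ1 γ10 γ11 γ12 γ20 γ21 η20 μ10 μ11 μ20 r1 r2 : ℝ) :
    ∀ p1 p2 : ℝ,
    ∀ v2 ∈ Submodule.span ℝ
        ({fun z => Real.exp (r1 * z), fun z => Real.exp (r2 * z)} : Set (ℝ → ℝ)),
      (Aop (fun w1 _ => κ1 ^ 2 * (γ10 + γ11 * w1 + (γ12 / 2) * w1 ^ 2))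
          (fun _ _ => 0)
          (fun w1 _ => μ10 + μ11 * w1)
          (fun z => p1 + p2 * z) v2
        ∈ Submodule.span ℝ ({fun _ => (1 : ℝ), fun z => z} : Set (ℝ → ℝ)))
      ∧
      (Aop (fun _ w2 => κ1 ^ 2 * (γ20 + γ21 * w2))
          (fun _ _ => κ1 ^ 2 * η20)
          (fun _ w2 => μ20 * w2)
          (fun z => p1 + p2 * z) v2
        ∈ Submodule.span ℝ
            ({fun z => Real.exp (r1 * z), fun z => Real.exp (r2 * z)} : Set (ℝ → ℝ))) := by
  intro p1 p2 v2 hv2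
  obtain ⟨a, b, rfl⟩ := Submodule.mem_span_pair.1 hv2
  have h1 : deriv (fun z : ℝ => p1 + p2 * z) = fun _ => p2 :=
    funext fun z => (hasDerivAt_affine p1 p2 z).deriv
  constructor
  · refine Submodule.mem_span_pair.2
      ⟨κ1 ^ 2 * p2 ^ 2 * (γ11 + γ12 * p1) + μ10 + μ11 * p1,
        κ1 ^ 2 * p2 ^ 3 * γ12 + μ11 * p2, funext fun z => ?_⟩
    have hz := hasDerivAt_affine p1 p2 z
    have key : HasDerivAt (fun w => κ1 ^ 2 * (γ10 + γ11 * (p1 + p2 * w) +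
        (γ12 / 2) * (p1 + p2 * w) ^ 2) * p2)
        (κ1 ^ 2 * p2 ^ 2 * (γ11 + γ12 * (p1 + p2 * z))) z :=
      (((((hz.const_mul γ11).const_add γ10).add
        ((hz.pow 2).const_mul (γ12 / 2))).const_mul (κ1 ^ 2)).mul_const p2).congr_deriv
        (by push_cast; ring)
    simp only [Aop, h1, zero_mul, add_zero, key.deriv, Pi.add_apply, Pi.smul_apply, smul_eq_mul]
    ring
  · have h2 : (a • fun z => Real.exp (r1 * z)) + (b • fun z => Real.exp (r2 * z)) =
        fun z => a * Real.exp (r1 * z) + b * Real.exp (r2 * z) := rfl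
    have h3 : deriv (fun z => a * Real.exp (r1 * z) + b * Real.exp (r2 * z)) =
        fun z => a * r1 * Real.exp (r1 * z) + b * r2 * Real.exp (r2 * z) :=
      funext fun z => (hasDerivAt_exp_combination a b r1 r2 z).deriv
    refine Submodule.mem_span_pair.2
      ⟨a * (κ1 ^ 2 * γ21 * p2 * r1 + κ1 ^ 2 * η20 * r1 ^ 2 + μ20),
        b * (κ1 ^ 2 * γ21 * p2 * r2 + κ1 ^ 2 * η20 * r2 ^ 2 + μ20), funext fun z => ?_⟩
    have key := ((((((hasDerivAt_exp_combination a b r1 r2 z).const_mul γ21).const_add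
      γ20).const_mul (κ1 ^ 2)).mul_const p2).fun_add
      ((hasDerivAt_exp_combination (a * r1) (b * r2) r1 r2 z).const_mul (κ1 ^ 2 * η20))).deriv
    simp only [h2, Aop, h1, h3, key, Pi.add_apply, Pi.smul_apply, smul_eq_mul]
    ring
end

section
/- Fix real parameters κ1, γ10, η10, η12, η20, η21, μ10, μ11, μ20, μ21 and λ ≠ 0. For twice continuously differentiable v1, v2 : ℝ → ℝ define A_1(v1,v2)(z) = d/dz[ κ1²·γ10·v1'(z) + κ1²·(η10 + η12·v2(z))·v2'(z) ] + μ10 + μ11·v1(z) and A_2(v1,v2)(z) = d/dz[ −(μ21/λ²)·v1'(z) + κ1²·(η20 + η21·v2(z))·v2'(z) ] + μ20 + μ21·v1(z). Let P1, P2, Q1, Q2 : ℝ → ℝ be differentiable functions satisfying, for all t: P1'(t) = μ10 + μ11·P1(t) + κ1²·η12·Q2(t)², P2'(t) = (κ1²·λ²·γ10 + μ11)·P2(t), Q1'(t) = μ20 + μ21·P1(t) + κ1²·η21·Q2(t)², Q2'(t) = 0. Then u1(z,t) = P1(t) + P2(t)·e^{−λz} and u2(z,t) = Q1(t) + Q2(t)·z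 satisfy ∂u1/∂t(z,t) = A_1(u1(·,t), u2(·,t))(z) and ∂u2/∂t(z,t) = A_2(u1(·,t), u2(·,t))(z) for all (z,t) ∈ ℝ². -/
/-- Example 3.1, α1 = α2 = 1: if `P1, P2, Q1, Q2` solve the coefficient
ODE system, then `u1(z,t) = P1(t) + P2(t)·e^{−λz}` and `u2(z,t) = Q1(t) + Q2(t)·z`
solve the reduced (1+1)-dimensional system `∂u_s/∂t = A_s(u1(·,t), u2(·,t))`. -/
theorem stmt11 (κ1 γ10 η10 η12 η20 η21 μ10 μ11 μ20 μ21 lam : ℝ) (hlam : lam ≠ 0)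
    (P1 P2 Q1 Q2 : ℝ → ℝ)
    (hP1 : Differentiable ℝ P1) (hP2 : Differentiable ℝ P2)
    (hQ1 : Differentiable ℝ Q1) (hQ2 : Differentiable ℝ Q2)
    (hP1' : ∀ t, deriv P1 t = μ10 + μ11 * P1 t + κ1 ^ 2 * η12 * (Q2 t) ^ 2)
    (hP2' : ∀ t, deriv P2 t = (κ1 ^ 2 * lam ^ 2 * γ10 + μ11) * P2 t)
    (hQ1' : ∀ t, deriv Q1 t = μ20 + μ21 * P1 t + κ1 ^ 2 * η21 * (Q2 t) ^ 2)
    (hQ2' : ∀ t, deriv Q2 t = 0) :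
    ∀ z t : ℝ,
      (deriv (fun τ => P1 τ + P2 τ * Real.exp (-lam * z)) t
        = Aop (fun _ _ => κ1 ^ 2 * γ10)
            (fun _ w2 => κ1 ^ 2 * (η10 + η12 * w2))
            (fun w1 _ => μ10 + μ11 * w1)
            (fun w => P1 t + P2 t * Real.exp (-lam * w))
            (fun w => Q1 t + Q2 t * w) z)
      ∧
      (deriv (fun τ => Q1 τ + Q2 τ * z) t
        = Aop (fun _ _ => -(μ21 / lam ^ 2))
            (fun _ w2 => κ1 ^ 2 * (η20 + η21 * w2))
            (fun w1 _ => μ20 + μ21 * w1)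
            (fun w => P1 t + P2 t * Real.exp (-lam * w))
            (fun w => Q1 t + Q2 t * w) z) := by
  intro z t
  have e : ∀ a c : ℝ, ∀ w : ℝ, HasDerivAt (fun x => a + c * Real.exp (-lam * x))
      (c * (-lam) * Real.exp (-lam * w)) w := by
    intro a c w
    have h := ((((hasDerivAt_id' w).const_mul (-lam)).exp).const_mul c).const_add a
    exact h.congr_deriv (by ring)
  have l : ∀ a c : ℝ, ∀ w : ℝ, HasDerivAt (fun x => a + c * x) c w := by
    intro a c w
    exact (((hasDerivAt_id' w).const_mul c).const_add a).congr_deriv (by ring)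
  have flux : ∀ D a b : ℝ, HasDerivAt
      (fun w => D * (P2 t * (-lam) * Real.exp (-lam * w))
        + κ1 ^ 2 * (a + b * (Q1 t + Q2 t * w)) * Q2 t)
      (D * lam ^ 2 * P2 t * Real.exp (-lam * z) + κ1 ^ 2 * b * Q2 t ^ 2) z := by
    intro D a b
    have h := ((e 0 (D * (P2 t * (-lam))) z).add
      (l (κ1 ^ 2 * (a + b * Q1 t) * Q2 t) (κ1 ^ 2 * b * Q2 t * Q2 t) z))
    refine (h.congr_deriv (by ring)).congr_of_eventuallyEq (.of_forall fun w => ?_)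
    simp only [Pi.add_apply]
    ring
  have d1 := ((hP1 t).hasDerivAt.add ((hP2 t).hasDerivAt.mul_const (Real.exp (-lam * z)))).deriv
  have d2 := ((hQ1 t).hasDerivAt.add ((hQ2 t).hasDerivAt.mul_const z)).deriv
  have e' := fun w => (e (P1 t) (P2 t) w).deriv
  have l' := fun w => (l (Q1 t) (Q2 t) w).deriv
  refine ⟨d1.trans ?_, d2.trans ?_⟩
  · simp only [Aop, e', l']
    rw [(flux _ _ _).deriv, hP1', hP2']
    ring
  · simp only [Aop, e', l']
    rw [(flux _ _ _).deriv, hQ1', hQ2']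
    field_simp
    ring
end

section
/- Fix real parameters κ1, γ10, η20, μ10, μ11, μ12, μ20, μ21, μ22 and λ > 0, and set θ = √(5λ/2). For twice continuously differentiable v1, v2 : ℝ → ℝ define A_1(v1,v2)(z) = d/dz[ (κ1²·γ10 + (2μ12/(3λ))·v2(z))·v1'(z) + ((μ11/λ) − (2μ12/(3λ))·v1(z))·v2'(z) ] + μ10·v1(z) + μ11·v2(z) + μ12·v1(z)·v2(z) and A_2(v1,v2)(z) = d/dz[ ((2μ20/(5λ)) + (2μ22/(3λ))·v2(z))·v1'(z) + (κ1²·η20 − (2μ22/(3λ))·v1(z))·v2'(z) ] + μ20·v1(z) + μ21·v2(z) + μ22·v1(z)·v2(z). Then for all p1, p2, q1, q2 ∈ ℝ, taking v1(z) = p1·sin(θz) + p2·cos(θz) and v2(z) = q1·sin(√λ·z) + q2·cos(√λ·z), one has A_1(v1,v2)(z) = (μ10 − (5/2)·κ1²·λ·γ10)·v1(z) and A_2(v1,v2)(z) = (μ21 − κ1²·λ·η20)·v2(z) for every z ∈ ℝ. -/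
/-- A trigonometric combination of frequency `c` has the expected derivative. -/
theorem hasDerivAt_trig (c p q w : ℝ) :
    HasDerivAt (fun x => p * Real.sin (c * x) + q * Real.cos (c * x))
      (c * (-q * Real.sin (c * w) + p * Real.cos (c * w))) w := by
  have hc : HasDerivAt (fun x => c * x) c w := by
    simpa using (hasDerivAt_id w).const_mul c
  exact ((hc.sin.const_mul p).add (hc.cos.const_mul q)).congr_deriv (by ring)

/-- The operator with flux `(A + k v2) v1' + (B - k v1) v2'` on trigonometric combinations of
frequencies `a` and `b`: the products of first derivatives cancel. -/
theorem Aop_trig (A B k a b p1 p2 q1 q2 z : ℝ) (h : ℝ → ℝ → ℝ) :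
    Aop (fun _ w2 => A + k * w2) (fun w1 _ => B - k * w1) h
        (fun w => p1 * Real.sin (a * w) + p2 * Real.cos (a * w))
        (fun w => q1 * Real.sin (b * w) + q2 * Real.cos (b * w)) z
      = -(a ^ 2 * A) * (p1 * Real.sin (a * z) + p2 * Real.cos (a * z))
        - b ^ 2 * B * (q1 * Real.sin (b * z) + q2 * Real.cos (b * z))
        + k * (b ^ 2 - a ^ 2) * (p1 * Real.sin (a * z) + p2 * Real.cos (a * z))
          * (q1 * Real.sin (b * z) + q2 * Real.cos (b * z))
        + h (p1 * Real.sin (a * z) + p2 * Real.cos (a * z))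
            (q1 * Real.sin (b * z) + q2 * Real.cos (b * z)) := by
  have h1 := hasDerivAt_trig a p1 p2 z
  have h2 := hasDerivAt_trig b q1 q2 z
  have h1' := (hasDerivAt_trig a (-p2) p1 z).const_mul a
  have h2' := (hasDerivAt_trig b (-q2) q1 z).const_mul b
  have hd := (((h2.const_mul k).const_add A).mul h1').add
    (((h1.const_mul k).const_sub B).mul h2')
  simp only [Aop, (hasDerivAt_trig _ _ _ _).deriv]
  refine congrArg (· + _) (hd.deriv.trans ?_)
  ring

/-- Example 3.2, μ13 = μ14 = μ23 = μ24 = 0: the product space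
`span{sin(θz), cos(θz)} × span{sin(√λ·z), cos(√λ·z)}` with `θ = √(5λ/2)` is invariant,
with the displayed scalar actions. -/
theorem stmt12 (κ1 γ10 η20 μ10 μ11 μ12 μ20 μ21 μ22 lam : ℝ) (hlam : 0 < lam)
    (θ : ℝ) (hθ : θ = Real.sqrt (5 * lam / 2)) :
    ∀ p1 p2 q1 q2 z : ℝ,
      (Aop (fun _ w2 => κ1 ^ 2 * γ10 + (2 * μ12 / (3 * lam)) * w2)
          (fun w1 _ => μ11 / lam - (2 * μ12 / (3 * lam)) * w1)
          (fun w1 w2 => μ10 * w1 + μ11 * w2 + μ12 * w1 * w2)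
          (fun w => p1 * Real.sin (θ * w) + p2 * Real.cos (θ * w))
          (fun w => q1 * Real.sin (Real.sqrt lam * w) + q2 * Real.cos (Real.sqrt lam * w)) z
        = (μ10 - (5 / 2) * κ1 ^ 2 * lam * γ10)
          * (p1 * Real.sin (θ * z) + p2 * Real.cos (θ * z)))
      ∧
      (Aop (fun _ w2 => 2 * μ20 / (5 * lam) + (2 * μ22 / (3 * lam)) * w2)
          (fun w1 _ => κ1 ^ 2 * η20 - (2 * μ22 / (3 * lam)) * w1)
          (fun w1 w2 => μ20 * w1 + μ21 * w2 + μ22 * w1 * w2)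
          (fun w => p1 * Real.sin (θ * w) + p2 * Real.cos (θ * w))
          (fun w => q1 * Real.sin (Real.sqrt lam * w) + q2 * Real.cos (Real.sqrt lam * w)) z
        = (μ21 - κ1 ^ 2 * lam * η20)
          * (q1 * Real.sin (Real.sqrt lam * z) + q2 * Real.cos (Real.sqrt lam * z))) := by
  intro p1 p2 q1 q2 z
  have ha : θ ^ 2 = 5 * lam / 2 := by rw [hθ, Real.sq_sqrt (by positivity)]
  have hb : Real.sqrt lam ^ 2 = lam := Real.sq_sqrt hlam.le
  rw [Aop_trig, Aop_trig, ha, hb]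
  constructor <;> field_simp <;> ring
end

section
/- Fix real parameters κ1, γ10, η20, μ10, μ11, μ12, μ20, μ21, μ22 and λ > 0, set θ = √(5λ/2), and define A_1, A_2 as follows: for twice continuously differentiable v1, v2 : ℝ → ℝ, A_1(v1,v2)(z) = d/dz[ (κ1²·γ10 + (2μ12/(3λ))·v2(z))·v1'(z) + ((μ11/λ) − (2μ12/(3λ))·v1(z))·v2'(z) ] + μ10·v1(z) + μ11·v2(z) + μ12·v1(z)·v2(z) and A_2(v1,v2)(z) = d/dz[ ((2μ20/(5λ)) + (2μ22/(3λ))·v2(z))·v1'(z) + (κ1²·η20 − (2μ22/(3λ))·v1(z))·v2'(z) ] + μ20·v1(z) + μ21·v2(z) + μ22·v1(z)·v2(z). Set ϱ1 = μ10 − (5/2)·κ1²·λ·γ10 and ϱ2 = μ21 − κ1²·λ·η20. Then for all ρ10, ρ20, ζ10, ζ20 ∈ ℝ, the functions u1(z,t) = (ρ10·sin(θz) + ρ20·cos(θz))·e^{ϱ1·t} and u2(z,t) = (ζ10·sin(√λ·z) + ζ20·cos(√λ·z))·e^{ϱ2·t} satisfy ∂u1/∂t(z,t) = A_1(u1(·,t),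 u2(·,t))(z) and ∂u2/∂t(z,t) = A_2(u1(·,t), u2(·,t))(z) for all (z,t) ∈ ℝ². -/
/-- A time slice `(a sin(ωz) + b cos(ωz)) c` and its first derivative. -/
theorem hasDerivAt_harmonic (a b c ω z : ℝ) :
    HasDerivAt (fun w => (a * Real.sin (ω * w) + b * Real.cos (ω * w)) * c)
      ((-(b * ω) * Real.sin (ω * z) + (a * ω) * Real.cos (ω * z)) * c) z := by
  have hω : HasDerivAt (fun w : ℝ => ω * w) ω z := by
    simpa using (hasDerivAt_id z).const_mul ω
  refine (((hω.sin.const_mul a).add (hω.cos.const_mul b)).mul_const c).congr_deriv ?_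
  ring

theorem deriv_mul_exp (a r t : ℝ) :
    deriv (fun τ => a * Real.exp (r * τ)) t = r * (a * Real.exp (r * t)) := by
  have hr : HasDerivAt (fun τ : ℝ => r * τ) r t := by
    simpa using (hasDerivAt_id t).const_mul r
  rw [(hr.exp.const_mul a).deriv]
  ring

/-- For a skew-symmetric quadratic part, `A` reduces to an expression without derivatives on
harmonic oscillations, since the products of first derivatives cancel. -/
theorem Aop_harmonic (p q k ω ν a b c d e f : ℝ) (h : ℝ → ℝ → ℝ) (z : ℝ) :
    Aop (fun _ w2 => p + k * w2) (fun w1 _ => q - k * w1) h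
        (fun w => (a * Real.sin (ω * w) + b * Real.cos (ω * w)) * c)
        (fun w => (d * Real.sin (ν * w) + e * Real.cos (ν * w)) * f) z
      = -(p * ω ^ 2) * ((a * Real.sin (ω * z) + b * Real.cos (ω * z)) * c)
        - q * ν ^ 2 * ((d * Real.sin (ν * z) + e * Real.cos (ν * z)) * f)
        + k * (ν ^ 2 - ω ^ 2) * ((a * Real.sin (ω * z) + b * Real.cos (ω * z)) * c)
          * ((d * Real.sin (ν * z) + e * Real.cos (ν * z)) * f)
        + h ((a * Real.sin (ω * z) + b * Real.cos (ω * z)) * c)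
          ((d * Real.sin (ν * z) + e * Real.cos (ν * z)) * f) := by
  have h1 := hasDerivAt_harmonic a b c ω
  have h2 := hasDerivAt_harmonic d e f ν
  have h1' := hasDerivAt_harmonic (-(b * ω)) (a * ω) c ω z
  have h2' := hasDerivAt_harmonic (-(e * ν)) (d * ν) f ν z
  have key := ((((h2 z).const_mul k).const_add p).mul h1').add
    ((((h1 z).const_mul k).const_sub q).mul h2')
  unfold Aop
  simp only [fun w => (h1 w).deriv, fun w => (h2 w).deriv]
  congr 1
  refine key.deriv.trans ?_
  ring

/-- Example 3.2, α1 = α2 = 1: the functions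
`u1(z,t) = (ρ10·sin(θz) + ρ20·cos(θz))·e^{ϱ1·t}` and
`u2(z,t) = (ζ10·sin(√λ·z) + ζ20·cos(√λ·z))·e^{ϱ2·t}` solve the reduced first-order-in-time
two-component system. -/
theorem stmt13 (κ1 γ10 η20 μ10 μ11 μ12 μ20 μ21 μ22 lam : ℝ) (hlam : 0 < lam)
    (θ : ℝ) (hθ : θ = Real.sqrt (5 * lam / 2))
    (ϱ1 ϱ2 : ℝ)
    (hϱ1 : ϱ1 = μ10 - (5 / 2) * κ1 ^ 2 * lam * γ10)
    (hϱ2 : ϱ2 = μ21 - κ1 ^ 2 * lam * η20) :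
    ∀ ρ10 ρ20 ζ10 ζ20 : ℝ, ∀ z t : ℝ,
      (deriv (fun τ => (ρ10 * Real.sin (θ * z) + ρ20 * Real.cos (θ * z)) * Real.exp (ϱ1 * τ)) t
        = Aop (fun _ w2 => κ1 ^ 2 * γ10 + (2 * μ12 / (3 * lam)) * w2)
            (fun w1 _ => μ11 / lam - (2 * μ12 / (3 * lam)) * w1)
            (fun w1 w2 => μ10 * w1 + μ11 * w2 + μ12 * w1 * w2)
            (fun w => (ρ10 * Real.sin (θ * w) + ρ20 * Real.cos (θ * w)) * Real.exp (ϱ1 * t))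
            (fun w => (ζ10 * Real.sin (Real.sqrt lam * w)
              + ζ20 * Real.cos (Real.sqrt lam * w)) * Real.exp (ϱ2 * t)) z)
      ∧
      (deriv (fun τ => (ζ10 * Real.sin (Real.sqrt lam * z)
            + ζ20 * Real.cos (Real.sqrt lam * z)) * Real.exp (ϱ2 * τ)) t
        = Aop (fun _ w2 => 2 * μ20 / (5 * lam) + (2 * μ22 / (3 * lam)) * w2)
            (fun w1 _ => κ1 ^ 2 * η20 - (2 * μ22 / (3 * lam)) * w1)
            (fun w1 w2 => μ20 * w1 + μ21 * w2 + μ22 * w1 * w2)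
            (fun w => (ρ10 * Real.sin (θ * w) + ρ20 * Real.cos (θ * w)) * Real.exp (ϱ1 * t))
            (fun w => (ζ10 * Real.sin (Real.sqrt lam * w)
              + ζ20 * Real.cos (Real.sqrt lam * w)) * Real.exp (ϱ2 * t)) z) := by
  intro ρ10 ρ20 ζ10 ζ20 z t
  have hθ2 : θ ^ 2 = 5 * lam / 2 := by rw [hθ, Real.sq_sqrt (by positivity)]
  have hl2 : Real.sqrt lam ^ 2 = lam := Real.sq_sqrt hlam.le
  have hne : lam ≠ 0 := hlam.ne'
  rw [deriv_mul_exp, deriv_mul_exp, Aop_harmonic, Aop_harmonic, hθ2, hl2, hϱ1, hϱ2]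
  constructor <;>
  · field_simp
    ring
end

section
/- Fix real parameters κ1, γ10, η20, μ10, μ11, μ12, μ20, μ21, μ22 and λ > 0, set θ = √(5λ/2), and define A_1, A_2 as follows: for twice continuously differentiable v1, v2 : ℝ → ℝ, A_1(v1,v2)(z) = d/dz[ (κ1²·γ10 + (2μ12/(3λ))·v2(z))·v1'(z) + ((μ11/λ) − (2μ12/(3λ))·v1(z))·v2'(z) ] + μ10·v1(z) + μ11·v2(z) + μ12·v1(z)·v2(z) and A_2(v1,v2)(z) = d/dz[ ((2μ20/(5λ)) + (2μ22/(3λ))·v2(z))·v1'(z) + (κ1²·η20 − (2μ22/(3λ))·v1(z))·v2'(z) ] + μ20·v1(z) + μ21·v2(z) + μ22·v1(z)·v2(z). Set ϱ1 = μ10 − (5/2)·κ1²·λ·γ10 and ϱ2 = μ21 − κ1²·λ·η20 and assume ϱ1 > 0 and ϱ2 > 0. Then for all ρ10, ρ20, ρ11, ρ21, ζ10, ζ20, ζ11, ζ21 ∈ ℝ, the functions u1(z,t) = (ρ10·sin(θz) + ρ20·cos(θz))·cosh(√ϱ1·t) + (ρ11·sin(θz) + ρ21·cos(θz))·sinh(√ϱ1·t)/√ϱ1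 and u2(z,t) = (ζ10·sin(√λ·z) + ζ20·cos(√λ·z))·cosh(√ϱ2·t) + (ζ11·sin(√λ·z) + ζ21·cos(√λ·z))·sinh(√ϱ2·t)/√ϱ2 satisfy ∂²u1/∂t²(z,t) = A_1(u1(·,t), u2(·,t))(z) and ∂²u2/∂t²(z,t) = A_2(u1(·,t), u2(·,t))(z) for all (z,t) ∈ ℝ². -/
/-- Cross diffusion with opposite linear coefficients reduces to a reaction term on
eigenfunctions of the second derivative. -/
theorem Aop_of_eigenfunctions (k c m a b : ℝ) (h : ℝ → ℝ → ℝ) {v1 v2 p1 p2 : ℝ → ℝ}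
    (h1 : ∀ w, HasDerivAt v1 (p1 w) w) (h2 : ∀ w, HasDerivAt v2 (p2 w) w)
    (h1' : ∀ w, HasDerivAt p1 (-a * v1 w) w) (h2' : ∀ w, HasDerivAt p2 (-b * v2 w) w)
    (z : ℝ) :
    Aop (fun _ w2 => k + c * w2) (fun w1 _ => m - c * w1) h v1 v2 z
      = -(a * k) * v1 z - b * m * v2 z + c * (b - a) * (v1 z * v2 z) + h (v1 z) (v2 z) := by
  have hd1 : deriv v1 = p1 := funext fun w => (h1 w).deriv
  have hd2 : deriv v2 = p2 := funext fun w => (h2 w).deriv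
  have hflux := ((((h2 z).const_mul c).const_add k).mul (h1' z)).add
    ((((h1 z).const_mul c).const_sub m).mul (h2' z))
  have key : deriv (fun w => (k + c * v2 w) * p1 w + (m - c * v1 w) * p2 w) z = _ :=
    hflux.deriv
  simp only [Aop, hd1, hd2]
  rw [key]
  ring

theorem hasDerivAt_sin_add_cos (p q s w : ℝ) :
    HasDerivAt (fun w => p * Real.sin (s * w) + q * Real.cos (s * w))
      (-(q * s) * Real.sin (s * w) + p * s * Real.cos (s * w)) w := by
  have hs : HasDerivAt (fun w => s * w) s w := by
    simpa using (hasDerivAt_id w).const_mul s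
  refine ((hs.sin.const_mul p).add (hs.cos.const_mul q)).congr_deriv ?_
  ring

theorem hasDerivAt_cosh_add_sinh (p q s w : ℝ) :
    HasDerivAt (fun w => p * Real.cosh (s * w) + q * Real.sinh (s * w))
      (q * s * Real.cosh (s * w) + p * s * Real.sinh (s * w)) w := by
  have hs : HasDerivAt (fun w => s * w) s w := by
    simpa using (hasDerivAt_id w).const_mul s
  refine ((hs.cosh.const_mul p).add (hs.sinh.const_mul q)).congr_deriv ?_
  ring

theorem deriv_deriv_cosh_add_sinh_div (p q s t : ℝ) :
    deriv (deriv fun τ => p * Real.cosh (s * τ) + q * Real.sinh (s * τ) / s) t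
      = s ^ 2 * (p * Real.cosh (s * t) + q * Real.sinh (s * t) / s) := by
  have hf : (fun τ => p * Real.cosh (s * τ) + q * Real.sinh (s * τ) / s)
      = fun τ => p * Real.cosh (s * τ) + q / s * Real.sinh (s * τ) := by
    funext τ
    ring
  rw [hf, funext fun τ => (hasDerivAt_cosh_add_sinh p (q / s) s τ).deriv,
    (hasDerivAt_cosh_add_sinh _ _ s t).deriv]
  ring

/-- A combination of two harmonics of frequency `s` has second derivative `-s ^ 2` times
itself. -/
theorem exists_hasDerivAt_harmonic (p q p' q' s C S r : ℝ) :
    ∃ g : ℝ → ℝ,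
      (∀ w, HasDerivAt (fun w => (p * Real.sin (s * w) + q * Real.cos (s * w)) * C
        + (p' * Real.sin (s * w) + q' * Real.cos (s * w)) * S / r) (g w) w) ∧
      ∀ w, HasDerivAt g (-s ^ 2 * ((p * Real.sin (s * w) + q * Real.cos (s * w)) * C
        + (p' * Real.sin (s * w) + q' * Real.cos (s * w)) * S / r)) w := by
  refine ⟨_, fun w => ((hasDerivAt_sin_add_cos p q s w).mul_const C).add
    (((hasDerivAt_sin_add_cos p' q' s w).mul_const S).div_const r), fun w => ?_⟩
  refine (((hasDerivAt_sin_add_cos (-(q * s)) (p * s) s w).mul_const C).add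
    (((hasDerivAt_sin_add_cos (-(q' * s)) (p' * s) s w).mul_const S).div_const r)).congr_deriv ?_
  ring

/-- Example 3.2, α1 = α2 = 2: the cosh/sinh separable functions solve the
reduced second-order-in-time two-component system. -/
theorem stmt14 (κ1 γ10 η20 μ10 μ11 μ12 μ20 μ21 μ22 lam : ℝ) (hlam : 0 < lam)
    (θ : ℝ) (hθ : θ = Real.sqrt (5 * lam / 2))
    (ϱ1 ϱ2 : ℝ)
    (hϱ1 : ϱ1 = μ10 - (5 / 2) * κ1 ^ 2 * lam * γ10)
    (hϱ2 : ϱ2 = μ21 - κ1 ^ 2 * lam * η20)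
    (hϱ1pos : 0 < ϱ1) (hϱ2pos : 0 < ϱ2) :
    ∀ ρ10 ρ20 ρ11 ρ21 ζ10 ζ20 ζ11 ζ21 : ℝ, ∀ z t : ℝ,
      (deriv (deriv (fun τ =>
          (ρ10 * Real.sin (θ * z) + ρ20 * Real.cos (θ * z)) * Real.cosh (Real.sqrt ϱ1 * τ)
          + (ρ11 * Real.sin (θ * z) + ρ21 * Real.cos (θ * z))
            * Real.sinh (Real.sqrt ϱ1 * τ) / Real.sqrt ϱ1)) t
        = Aop (fun _ w2 => κ1 ^ 2 * γ10 + (2 * μ12 / (3 * lam)) * w2)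
            (fun w1 _ => μ11 / lam - (2 * μ12 / (3 * lam)) * w1)
            (fun w1 w2 => μ10 * w1 + μ11 * w2 + μ12 * w1 * w2)
            (fun w => (ρ10 * Real.sin (θ * w) + ρ20 * Real.cos (θ * w))
                * Real.cosh (Real.sqrt ϱ1 * t)
              + (ρ11 * Real.sin (θ * w) + ρ21 * Real.cos (θ * w))
                * Real.sinh (Real.sqrt ϱ1 * t) / Real.sqrt ϱ1)
            (fun w => (ζ10 * Real.sin (Real.sqrt lam * w)
                + ζ20 * Real.cos (Real.sqrt lam * w)) * Real.cosh (Real.sqrt ϱ2 * t)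
              + (ζ11 * Real.sin (Real.sqrt lam * w) + ζ21 * Real.cos (Real.sqrt lam * w))
                * Real.sinh (Real.sqrt ϱ2 * t) / Real.sqrt ϱ2) z)
      ∧
      (deriv (deriv (fun τ =>
          (ζ10 * Real.sin (Real.sqrt lam * z) + ζ20 * Real.cos (Real.sqrt lam * z))
            * Real.cosh (Real.sqrt ϱ2 * τ)
          + (ζ11 * Real.sin (Real.sqrt lam * z) + ζ21 * Real.cos (Real.sqrt lam * z))
            * Real.sinh (Real.sqrt ϱ2 * τ) / Real.sqrt ϱ2)) t
        = Aop (fun _ w2 => 2 * μ20 / (5 * lam) + (2 * μ22 / (3 * lam)) * w2)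
            (fun w1 _ => κ1 ^ 2 * η20 - (2 * μ22 / (3 * lam)) * w1)
            (fun w1 w2 => μ20 * w1 + μ21 * w2 + μ22 * w1 * w2)
            (fun w => (ρ10 * Real.sin (θ * w) + ρ20 * Real.cos (θ * w))
                * Real.cosh (Real.sqrt ϱ1 * t)
              + (ρ11 * Real.sin (θ * w) + ρ21 * Real.cos (θ * w))
                * Real.sinh (Real.sqrt ϱ1 * t) / Real.sqrt ϱ1)
            (fun w => (ζ10 * Real.sin (Real.sqrt lam * w)
                + ζ20 * Real.cos (Real.sqrt lam * w)) * Real.cosh (Real.sqrt ϱ2 * t)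
              + (ζ11 * Real.sin (Real.sqrt lam * w) + ζ21 * Real.cos (Real.sqrt lam * w))
                * Real.sinh (Real.sqrt ϱ2 * t) / Real.sqrt ϱ2) z) := by
  intro ρ10 ρ20 ρ11 ρ21 ζ10 ζ20 ζ11 ζ21 z t
  have hθ2 : θ ^ 2 = 5 * lam / 2 := by rw [hθ, Real.sq_sqrt (by positivity)]
  obtain ⟨p1, h1, h1'⟩ := exists_hasDerivAt_harmonic ρ10 ρ20 ρ11 ρ21 θ
    (Real.cosh (Real.sqrt ϱ1 * t)) (Real.sinh (Real.sqrt ϱ1 * t)) (Real.sqrt ϱ1)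
  obtain ⟨p2, h2, h2'⟩ := exists_hasDerivAt_harmonic ζ10 ζ20 ζ11 ζ21 (Real.sqrt lam)
    (Real.cosh (Real.sqrt ϱ2 * t)) (Real.sinh (Real.sqrt ϱ2 * t)) (Real.sqrt ϱ2)
  rw [hθ2] at h1'
  rw [Real.sq_sqrt hlam.le] at h2'
  have hdiff (k m x y : ℝ) (μ : ℝ) :
      -(5 * lam / 2 * k) * x - lam * m * y + 2 * μ / (3 * lam) * (lam - 5 * lam / 2) * (x * y)
        = -(5 * lam / 2 * k) * x - lam * m * y - μ * (x * y) := by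
    field_simp
    ring
  constructor
  · rw [deriv_deriv_cosh_add_sinh_div, Real.sq_sqrt hϱ1pos.le,
      Aop_of_eigenfunctions _ _ _ _ _ _ h1 h2 h1' h2', hϱ1]
    rw [hdiff, show lam * (μ11 / lam) = μ11 by field_simp]
    ring
  · rw [deriv_deriv_cosh_add_sinh_div, Real.sq_sqrt hϱ2pos.le,
      Aop_of_eigenfunctions _ _ _ _ _ _ h1 h2 h1' h2', hϱ2]
    rw [hdiff, show 5 * lam / 2 * (2 * μ20 / (5 * lam)) = μ20 by field_simp]
    ring
end

section
/- Fix real parameters κ1, γ10, η20, μ10, μ11, μ12, μ20, μ21, μ22 and β ≠ 0, and define A_1, A_2 as follows: for twice continuously differentiable v1, v2 : ℝ → ℝ, A_1(v1,v2)(z) = d/dz[ (κ1²·γ10 + (μ12/(3β²))·v2(z))·v1'(z) − ((μ11/β²) + (μ12/(3β²))·v1(z))·v2'(z) ] + μ10·v1(z) + μ11·v2(z) + μ12·v1(z)·v2(z) and A_2(v1,v2)(z) = d/dz[ ((μ20/(2β²)) + (μ22/(3β²))·v2(z))·v1'(z) + (κ1²·η20 − (μ22/(3β²))·v1(z))·v2'(z)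 ] + μ20·v1(z) + μ21·v2(z) + μ22·v1(z)·v2(z). Set ϱ1 = μ10 − 2β²·κ1²·γ10 and ϱ2 = μ21 + β²·κ1²·η20. Then for all ρ10, ρ20, ζ10, ζ20 ∈ ℝ, the functions u1(z,t) = (ρ10·sin(√2·β·z) + ρ20·cos(√2·β·z))·e^{ϱ1·t} and u2(z,t) = (ζ10·e^{−βz} + ζ20·e^{βz})·e^{ϱ2·t} satisfy ∂u1/∂t(z,t) = A_1(u1(·,t), u2(·,t))(z) and ∂u2/∂t(z,t) = A_2(u1(·,t), u2(·,t))(z) for all (z,t) ∈ ℝ². -/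
/-- The value of `Aop` for coefficients `Φ = a + b·v2`, `Ψ = c + d·v1` on functions with
`v1'' = l1·v1` and `v2'' = l2·v2`. -/
theorem Aop_affine_of_hasDerivAt (a b c d l1 l2 : ℝ) (h : ℝ → ℝ → ℝ) {v1 v2 w1 w2 : ℝ → ℝ}
    (h1 : ∀ x, HasDerivAt v1 (w1 x) x) (h2 : ∀ x, HasDerivAt v2 (w2 x) x)
    (h1' : ∀ x, HasDerivAt w1 (l1 * v1 x) x) (h2' : ∀ x, HasDerivAt w2 (l2 * v2 x) x) (z : ℝ) :
    Aop (fun _ y => a + b * y) (fun x _ => c + d * x) h v1 v2 z =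
      a * l1 * v1 z + c * l2 * v2 z + (b * l1 + d * l2) * (v1 z * v2 z)
        + (b + d) * (w1 z * w2 z) + h (v1 z) (v2 z) := by
  have e1 : deriv v1 = w1 := funext fun x => (h1 x).deriv
  have e2 : deriv v2 = w2 := funext fun x => (h2 x).deriv
  have key := ((((h2 z).const_mul b).const_add a).fun_mul (h1' z)).fun_add
    ((((h1 z).const_mul d).const_add c).fun_mul (h2' z))
  rw [Aop, e1, e2, key.deriv]
  ring

theorem hasDerivAt_sin_cos_mul (p q k C x : ℝ) :
    HasDerivAt (fun w => (p * Real.sin (k * w) + q * Real.cos (k * w)) * C)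
      ((-(k * q) * Real.sin (k * x) + k * p * Real.cos (k * x)) * C) x := by
  have hk : HasDerivAt (fun w : ℝ => k * w) k x := by simpa using (hasDerivAt_id x).const_mul k
  exact (((hk.sin.const_mul p).fun_add (hk.cos.const_mul q)).mul_const C).congr_deriv
    (by ring)

theorem hasDerivAt_exp_neg_exp_mul (p q k C x : ℝ) :
    HasDerivAt (fun w => (p * Real.exp (-k * w) + q * Real.exp (k * w)) * C)
      ((-(k * p) * Real.exp (-k * x) + k * q * Real.exp (k * x)) * C) x := by
  have hk (k : ℝ) : HasDerivAt (fun w : ℝ => k * w) k x := by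
    simpa using (hasDerivAt_id x).const_mul k
  exact ((((hk (-k)).exp.const_mul p).fun_add ((hk k).exp.const_mul q)).mul_const C).congr_deriv
    (by ring)

theorem deriv_const_mul_exp_mul (A r t : ℝ) :
    deriv (fun τ => A * Real.exp (r * τ)) t = r * (A * Real.exp (r * t)) := by
  have hr : HasDerivAt (fun τ : ℝ => r * τ) r t := by simpa using (hasDerivAt_id t).const_mul r
  rw [(hr.exp.const_mul A).deriv]
  ring

/-- Example 3.3, α = 1: the functions
`u1(z,t) = (ρ10·sin(√2·βz) + ρ20·cos(√2·βz))·e^{ϱ1·t}` and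
`u2(z,t) = (ζ10·e^{−βz} + ζ20·e^{βz})·e^{ϱ2·t}` solve the reduced first-order-in-time
two-component system. -/
theorem stmt16 (κ1 γ10 η20 μ10 μ11 μ12 μ20 μ21 μ22 β : ℝ) (hβ : β ≠ 0)
    (ϱ1 ϱ2 : ℝ)
    (hϱ1 : ϱ1 = μ10 - 2 * β ^ 2 * κ1 ^ 2 * γ10)
    (hϱ2 : ϱ2 = μ21 + β ^ 2 * κ1 ^ 2 * η20) :
    ∀ ρ10 ρ20 ζ10 ζ20 : ℝ, ∀ z t : ℝ,
      (deriv (fun τ => (ρ10 * Real.sin (Real.sqrt 2 * β * z)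
          + ρ20 * Real.cos (Real.sqrt 2 * β * z)) * Real.exp (ϱ1 * τ)) t
        = Aop (fun _ w2 => κ1 ^ 2 * γ10 + (μ12 / (3 * β ^ 2)) * w2)
            (fun w1 _ => -(μ11 / β ^ 2 + (μ12 / (3 * β ^ 2)) * w1))
            (fun w1 w2 => μ10 * w1 + μ11 * w2 + μ12 * w1 * w2)
            (fun w => (ρ10 * Real.sin (Real.sqrt 2 * β * w)
              + ρ20 * Real.cos (Real.sqrt 2 * β * w)) * Real.exp (ϱ1 * t))
            (fun w => (ζ10 * Real.exp (-β * w) + ζ20 * Real.exp (β * w))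
              * Real.exp (ϱ2 * t)) z)
      ∧
      (deriv (fun τ => (ζ10 * Real.exp (-β * z) + ζ20 * Real.exp (β * z))
          * Real.exp (ϱ2 * τ)) t
        = Aop (fun _ w2 => μ20 / (2 * β ^ 2) + (μ22 / (3 * β ^ 2)) * w2)
            (fun w1 _ => κ1 ^ 2 * η20 - (μ22 / (3 * β ^ 2)) * w1)
            (fun w1 w2 => μ20 * w1 + μ21 * w2 + μ22 * w1 * w2)
            (fun w => (ρ10 * Real.sin (Real.sqrt 2 * β * w)
              + ρ20 * Real.cos (Real.sqrt 2 * β * w)) * Real.exp (ϱ1 * t))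
            (fun w => (ζ10 * Real.exp (-β * w) + ζ20 * Real.exp (β * w))
              * Real.exp (ϱ2 * t)) z) := by
  intro ρ10 ρ20 ζ10 ζ20 z t
  have h1 := hasDerivAt_sin_cos_mul ρ10 ρ20 (Real.sqrt 2 * β) (Real.exp (ϱ1 * t))
  have h2 := hasDerivAt_exp_neg_exp_mul ζ10 ζ20 β (Real.exp (ϱ2 * t))
  have hs : Real.sqrt 2 ^ 2 = 2 := Real.sq_sqrt zero_le_two
  have h1' (x : ℝ) := (hasDerivAt_sin_cos_mul (-(Real.sqrt 2 * β * ρ20)) (Real.sqrt 2 * β * ρ10)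
    (Real.sqrt 2 * β) (Real.exp (ϱ1 * t)) x).congr_deriv
    (g' := -2 * β ^ 2 * ((ρ10 * Real.sin (Real.sqrt 2 * β * x)
      + ρ20 * Real.cos (Real.sqrt 2 * β * x)) * Real.exp (ϱ1 * t)))
    (by ring_nf; rw [hs]; ring)
  have h2' (x : ℝ) := (hasDerivAt_exp_neg_exp_mul (-(β * ζ10)) (β * ζ20) β
    (Real.exp (ϱ2 * t)) x).congr_deriv
    (g' := β ^ 2 * ((ζ10 * Real.exp (-β * x) + ζ20 * Real.exp (β * x)) * Real.exp (ϱ2 * t)))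
    (by ring)
  have eΨ1 : (fun w1 _ : ℝ => -(μ11 / β ^ 2 + μ12 / (3 * β ^ 2) * w1)) =
      fun w1 _ => -(μ11 / β ^ 2) + -(μ12 / (3 * β ^ 2)) * w1 := by
    funext; ring
  have eΨ2 : (fun w1 _ : ℝ => κ1 ^ 2 * η20 - μ22 / (3 * β ^ 2) * w1) =
      fun w1 _ => κ1 ^ 2 * η20 + -(μ22 / (3 * β ^ 2)) * w1 := by
    funext; ring
  rw [eΨ1, eΨ2, Aop_affine_of_hasDerivAt _ _ _ _ _ _ _ h1 h2 h1' h2',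
    Aop_affine_of_hasDerivAt _ _ _ _ _ _ _ h1 h2 h1' h2',
    deriv_const_mul_exp_mul, deriv_const_mul_exp_mul]
  generalize (ρ10 * Real.sin (Real.sqrt 2 * β * z) + ρ20 * Real.cos (Real.sqrt 2 * β * z))
    * Real.exp (ϱ1 * t) = U
  generalize (ζ10 * Real.exp (-β * z) + ζ20 * Real.exp (β * z)) * Real.exp (ϱ2 * t) = V
  rw [add_neg_cancel, add_neg_cancel, hϱ1, hϱ2]
  constructor <;> field_simp <;> ring
end

section
/- Let v : ℝ² → ℝ, written (x,t) ↦ v(x,t), be smooth (C^∞) with v(x,t) > 0 for all (x,t), and suppose that B(v)(x,t) = 0 for all (x,t), where B(v) = v·v_{xt} − v_t·v_x + v·v_{xxxx} − 4·v_x·v_{xxx} + 3·(v_{xx})². Then the function u := 2·∂²/∂x²(log v) satisfies the Korteweg–de Vries equation ∂u/∂t = −6·u·∂u/∂x − ∂³u/∂x³ at every point of ℝ². -/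
/-- Partial derivative in the first (space) variable `x`. -/
noncomputable def dX (w : ℝ × ℝ → ℝ) (p : ℝ × ℝ) : ℝ :=
  deriv (fun x => w (x, p.2)) p.1

/-- Partial derivative in the second (time) variable `t`. -/
noncomputable def dT (w : ℝ × ℝ → ℝ) (p : ℝ × ℝ) : ℝ :=
  deriv (fun t => w (p.1, t)) p.2

/-- The bilinear expression
`B(v) = v·v_{xt} − v_t·v_x + v·v_{xxxx} − 4·v_x·v_{xxx} + 3·(v_{xx})²`
obtained from the KdV equation by the substitution `u = 2(log v)_{xx}`. -/
noncomputable def Bop (v : ℝ × ℝ → ℝ) (p : ℝ × ℝ) : ℝ :=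
  v p * dX (dT v) p - dT v p * dX v p + v p * dX (dX (dX (dX v))) p
  - 4 * dX v p * dX (dX (dX v)) p + 3 * (dX (dX v) p) ^ 2

theorem dX_eq_fderiv {w : ℝ × ℝ → ℝ} (hw : Differentiable ℝ w) (p : ℝ × ℝ) :
    dX w p = fderiv ℝ w p (1, 0) :=
  ((hw (p.1, p.2)).hasFDerivAt.comp_hasDerivAt p.1
    ((hasDerivAt_id p.1).prodMk (hasDerivAt_const p.1 p.2))).deriv

theorem dT_eq_fderiv {w : ℝ × ℝ → ℝ} (hw : Differentiable ℝ w) (p : ℝ × ℝ) :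
    dT w p = fderiv ℝ w p (0, 1) :=
  ((hw (p.1, p.2)).hasFDerivAt.comp_hasDerivAt p.2
    ((hasDerivAt_const p.2 p.1).prodMk (hasDerivAt_id p.2))).deriv

theorem contDiff_dX {w : ℝ × ℝ → ℝ} (hw : ContDiff ℝ (⊤ : ℕ∞) w) :
    ContDiff ℝ (⊤ : ℕ∞) (dX w) := by
  rw [funext (dX_eq_fderiv (hw.differentiable (by simp)))]
  exact (hw.fderiv_right (by simp)).clm_apply contDiff_const

theorem contDiff_dT {w : ℝ × ℝ → ℝ} (hw : ContDiff ℝ (⊤ : ℕ∞) w) :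
    ContDiff ℝ (⊤ : ℕ∞) (dT w) := by
  rw [funext (dT_eq_fderiv (hw.differentiable (by simp)))]
  exact (hw.fderiv_right (by simp)).clm_apply contDiff_const

theorem dT_dX_comm {w : ℝ × ℝ → ℝ} (hw : ContDiff ℝ (⊤ : ℕ∞) w) :
    dT (dX w) = dX (dT w) := by
  have hd : Differentiable ℝ w := hw.differentiable (by simp)
  have hd' : Differentiable ℝ (fderiv ℝ w) :=
    (hw.fderiv_right (m := (⊤ : ℕ∞)) (by simp)).differentiable (by simp)
  funext p
  rw [dT_eq_fderiv ((contDiff_dX hw).differentiable (by simp)),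
    dX_eq_fderiv ((contDiff_dT hw).differentiable (by simp)),
    funext (dX_eq_fderiv hd), funext (dT_eq_fderiv hd),
    fderiv_clm_apply (hd' p) (differentiableAt_const _),
    fderiv_clm_apply (hd' p) (differentiableAt_const _)]
  have hsymm : IsSymmSndFDerivAt ℝ w p :=
    (hw.of_le (m := 2) (WithTop.coe_le_coe.2 le_top)).contDiffAt.isSymmSndFDerivAt (by simp)
  simpa using hsymm.eq (0, 1) (1, 0)

theorem hasDerivAt_dX {w : ℝ × ℝ → ℝ} (hw : ContDiff ℝ (⊤ : ℕ∞) w) (p : ℝ × ℝ) :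
    HasDerivAt (fun x => w (x, p.2)) (dX w p) p.1 := by
  have hd : Differentiable ℝ w := hw.differentiable (by simp)
  exact DifferentiableAt.hasDerivAt (by fun_prop)

theorem hasDerivAt_dT {w : ℝ × ℝ → ℝ} (hw : ContDiff ℝ (⊤ : ℕ∞) w) (p : ℝ × ℝ) :
    HasDerivAt (fun t => w (p.1, t)) (dT w p) p.2 := by
  have hd : Differentiable ℝ w := hw.differentiable (by simp)
  exact DifferentiableAt.hasDerivAt (by fun_prop)

theorem dX_const_mul (c : ℝ) (w : ℝ × ℝ → ℝ) :
    dX (fun q => c * w q) = fun q => c * dX w q :=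
  funext fun _ => deriv_const_mul_field c

theorem dT_const_mul (c : ℝ) (w : ℝ × ℝ → ℝ) :
    dT (fun q => c * w q) = fun q => c * dT w q :=
  funext fun _ => deriv_const_mul_field c

theorem dX_exp {g : ℝ × ℝ → ℝ} (hg : ContDiff ℝ (⊤ : ℕ∞) g) :
    dX (fun q => Real.exp (g q)) = fun q => Real.exp (g q) * dX g q :=
  funext fun q => (hasDerivAt_dX hg q).exp.deriv

theorem dT_exp {g : ℝ × ℝ → ℝ} (hg : ContDiff ℝ (⊤ : ℕ∞) g) :
    dT (fun q => Real.exp (g q)) = fun q => Real.exp (g q) * dT g q :=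
  funext fun q => (hasDerivAt_dT hg q).exp.deriv

theorem dX_exp_mul {g h : ℝ × ℝ → ℝ} (hg : ContDiff ℝ (⊤ : ℕ∞) g)
    (hh : ContDiff ℝ (⊤ : ℕ∞) h) :
    dX (fun q => Real.exp (g q) * h q) =
      fun q => Real.exp (g q) * (dX g q * h q + dX h q) := by
  funext q
  refine ((hasDerivAt_dX hg q).exp.mul (hasDerivAt_dX hh q)).deriv.trans ?_
  ring

/-- In terms of `g = log v`, the bilinear form is `v ^ 2 * (g_xt + g_xxxx + 6 * g_xx ^ 2)`. -/
theorem Bop_exp {g : ℝ × ℝ → ℝ} (hg : ContDiff ℝ (⊤ : ℕ∞) g) (p : ℝ × ℝ) :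
    Bop (fun q => Real.exp (g q)) p =
      Real.exp (g p) ^ 2 *
        (dX (dT g) p + dX (dX (dX (dX g))) p + 6 * dX (dX g) p ^ 2) := by
  have h1 := contDiff_dX hg
  have h2 := contDiff_dX h1
  have h3 := contDiff_dX h2
  have e2 : dX (fun q => dX g q * dX g q + dX (dX g) q) =
      fun q => 2 * dX g q * dX (dX g) q + dX (dX (dX g)) q := by
    funext q
    refine (((hasDerivAt_dX h1 q).mul (hasDerivAt_dX h1 q)).add
      (hasDerivAt_dX h2 q)).deriv.trans ?_
    ring
  have e3 : dX (fun q => dX g q * (dX g q * dX g q + dX (dX g) q) +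
        (2 * dX g q * dX (dX g) q + dX (dX (dX g)) q)) =
      fun q => 3 * dX g q ^ 2 * dX (dX g) q + 3 * dX (dX g) q ^ 2
        + 3 * dX g q * dX (dX (dX g)) q + dX (dX (dX (dX g))) q := by
    funext q
    have d1 := hasDerivAt_dX h1 q
    have d2 := hasDerivAt_dX h2 q
    have d3 := hasDerivAt_dX h3 q
    refine ((d1.mul ((d1.mul d1).add d2)).add
      (((d1.const_mul 2).mul d2).add d3)).deriv.trans ?_
    simp only [Pi.mul_apply, Pi.add_apply]
    ring
  simp only [Bop]
  rw [dX_exp hg, dT_exp hg, dX_exp_mul hg h1, dX_exp_mul hg (contDiff_dT hg),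
    dX_exp_mul hg (by fun_prop), e2, dX_exp_mul hg (by fun_prop), e3]
  ring

/-- if `v` is smooth, positive, and satisfies `B(v) = 0` everywhere, then
`u = 2·(log v)_{xx}` solves the KdV equation `u_t = −6·u·u_x − u_{xxx}`. -/
theorem stmt17 (v : ℝ × ℝ → ℝ) (hv : ContDiff ℝ (⊤ : ℕ∞) v) (hpos : ∀ p, 0 < v p)
    (hB : ∀ p, Bop v p = 0) :
    ∀ u : ℝ × ℝ → ℝ, u = (fun q => 2 * dX (dX (fun r => Real.log (v r))) q) →
      ∀ p : ℝ × ℝ, dT u p = -6 * u p * dX u p - dX (dX (dX u)) p := by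
  rintro u rfl p
  set g : ℝ × ℝ → ℝ := fun r => Real.log (v r)
  have hg : ContDiff ℝ (⊤ : ℕ∞) g := hv.log fun q => (hpos q).ne'
  have hvg : v = fun q => Real.exp (g q) := funext fun q => (Real.exp_log (hpos q)).symm
  have hxt : dX (dT g) = fun q => -(dX (dX (dX (dX g))) q + 6 * dX (dX g) q ^ 2) := by
    funext q
    have h := hB q
    rw [hvg, Bop_exp hg] at h
    have := (mul_eq_zero.mp h).resolve_left (pow_ne_zero 2 (Real.exp_pos _).ne')
    linarith
  have h2 := contDiff_dX (contDiff_dX hg)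
  have h4 := contDiff_dX (contDiff_dX h2)
  have hxxt : dX (dX (dT g)) p =
      -(dX (dX (dX (dX (dX g)))) p + 12 * dX (dX g) p * dX (dX (dX g)) p) := by
    rw [hxt]
    refine ((hasDerivAt_dX h4 p).add
      (((hasDerivAt_dX h2 p).pow 2).const_mul 6)).neg.deriv.trans ?_
    push_cast
    ring
  simp only [dX_const_mul, dT_const_mul]
  rw [dT_dX_comm (contDiff_dX hg), dT_dX_comm hg, hxxt]
  ring
end

section
/- Let a ∈ ℝ and b > 0. Then the function u(x,t) = 2·∂²/∂x²( log(1 + b·e^{a·x − a³·t}) ) satisfies the Korteweg–de Vries equation ∂u/∂t = −6·u·∂u/∂x − ∂³u/∂x³ at every point (x,t) ∈ ℝ². -/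
open Polynomial in
/-- A polynomial in a function `s` with `s' = c·s·(1 - s)` has a derivative that is again a
polynomial in `s`. -/
theorem hasDerivAt_eval_logistic {s : ℝ → ℝ} {c y : ℝ}
    (hs : HasDerivAt s (c * (s y * (1 - s y))) y) (P : ℝ[X]) :
    HasDerivAt (fun z => P.eval (s z)) ((C c * (X * (1 - X)) * derivative P).eval (s y)) y := by
  refine ((P.hasDerivAt (s y)).comp y hs).congr_deriv ?_
  simp only [eval_mul, eval_C, eval_X, eval_sub, eval_one]
  ring

/-- The logistic profile `b·e^{ax - ct} / (1 + b·e^{ax - ct})`. -/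
noncomputable def logistic (a b c : ℝ) (p : ℝ × ℝ) : ℝ :=
  b * Real.exp (a * p.1 - c * p.2) / (1 + b * Real.exp (a * p.1 - c * p.2))

theorem hasDerivAt_logistic_comp {b k y : ℝ} (hb : 0 < b) {f : ℝ → ℝ} (hf : HasDerivAt f k y) :
    HasDerivAt (fun z => b * Real.exp (f z) / (1 + b * Real.exp (f z)))
      (k * (b * Real.exp (f y) / (1 + b * Real.exp (f y)) *
        (1 - b * Real.exp (f y) / (1 + b * Real.exp (f y))))) y := by
  have hne : 1 + b * Real.exp (f y) ≠ 0 := by positivity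
  refine ((hf.exp.const_mul b).fun_div ((hf.exp.const_mul b).const_add 1) hne).congr_deriv ?_
  field_simp

theorem hasDerivAt_logistic_fst (a c : ℝ) {b : ℝ} (hb : 0 < b) (p : ℝ × ℝ) :
    HasDerivAt (fun x => logistic a b c (x, p.2))
      (a * (logistic a b c p * (1 - logistic a b c p))) p.1 := by
  have hf : HasDerivAt (fun x => a * x - c * p.2) a p.1 := by
    simpa using ((hasDerivAt_id p.1).const_mul a).sub_const (c * p.2)
  exact hasDerivAt_logistic_comp hb hf

theorem hasDerivAt_logistic_snd (a c : ℝ) {b : ℝ} (hb : 0 < b) (p : ℝ × ℝ) :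
    HasDerivAt (fun t => logistic a b c (p.1, t))
      (-c * (logistic a b c p * (1 - logistic a b c p))) p.2 := by
  have hf : HasDerivAt (fun t => a * p.1 - c * t) (-c) p.2 := by
    simpa using ((hasDerivAt_id p.2).const_mul c).const_sub (a * p.1)
  exact hasDerivAt_logistic_comp hb hf

open Polynomial in
theorem dX_eval_logistic (a c : ℝ) {b : ℝ} (hb : 0 < b) (P : ℝ[X]) :
    dX (fun p => P.eval (logistic a b c p)) =
      fun p => (C a * (X * (1 - X)) * derivative P).eval (logistic a b c p) :=
  funext fun p => (hasDerivAt_eval_logistic (hasDerivAt_logistic_fst a c hb p) P).deriv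

open Polynomial in
theorem dT_eval_logistic (a c : ℝ) {b : ℝ} (hb : 0 < b) (P : ℝ[X]) :
    dT (fun p => P.eval (logistic a b c p)) =
      fun p => (C (-c) * (X * (1 - X)) * derivative P).eval (logistic a b c p) :=
  funext fun p => (hasDerivAt_eval_logistic (hasDerivAt_logistic_snd a c hb p) P).deriv

open Polynomial in
theorem dX_log_one_add_exp (a c : ℝ) {b : ℝ} (hb : 0 < b) :
    dX (fun q => Real.log (1 + b * Real.exp (a * q.1 - c * q.2))) =
      fun p => (C a * X).eval (logistic a b c p) := by
  funext p
  have hf : HasDerivAt (fun x => a * x - c * p.2) a p.1 := by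
    simpa using ((hasDerivAt_id p.1).const_mul a).sub_const (c * p.2)
  have hne : 1 + b * Real.exp (a * p.1 - c * p.2) ≠ 0 := by positivity
  refine (((hf.exp.const_mul b).const_add 1).log hne).deriv.trans ?_
  simp only [eval_mul, eval_C, eval_X, logistic]
  ring

/-- for `a ∈ ℝ` and `b > 0`, the 1-soliton
`u(x,t) = 2·∂²/∂x²(log(1 + b·e^{a·x − a³·t}))` solves the KdV equation
`u_t = −6·u·u_x − u_{xxx}`. -/
theorem stmt19 (a b : ℝ) (hb : 0 < b) :
    ∀ u : ℝ × ℝ → ℝ,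
      u = (fun p => 2 * dX (dX (fun q =>
            Real.log (1 + b * Real.exp (a * q.1 - a ^ 3 * q.2)))) p) →
      ∀ p : ℝ × ℝ, dT u p = -6 * u p * dX u p - dX (dX (dX u)) p := by
  intro u hu p
  have hu' : u = fun p => (Polynomial.C (2 * a ^ 2) *
      (Polynomial.X * (1 - Polynomial.X))).eval (logistic a b (a ^ 3) p) := by
    rw [hu, dX_log_one_add_exp a (a ^ 3) hb, dX_eval_logistic a (a ^ 3) hb]
    funext p
    simp
    ring
  rw [hu', dT_eval_logistic a (a ^ 3) hb, dX_eval_logistic a (a ^ 3) hb,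
    dX_eval_logistic a (a ^ 3) hb, dX_eval_logistic a (a ^ 3) hb]
  simp only [Polynomial.derivative_mul, Polynomial.derivative_C, Polynomial.derivative_X,
    Polynomial.derivative_sub, Polynomial.derivative_one, Polynomial.derivative_add,
    Polynomial.derivative_zero, Polynomial.eval_mul, Polynomial.eval_add, Polynomial.eval_sub,
    Polynomial.eval_C, Polynomial.eval_X, Polynomial.eval_one, Polynomial.eval_zero]
  ring
end
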